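/- Let m ≥ 1 and for j = 1,…,m let (λ^{(j)}_k)_{k≥1} be a nondecreasing sequence of positive real numbers tending to infinity, with counting function N_j(λ) = #{k ∈ ℕ_{≥1} : λ^{(j)}_k ≤ λ}. Suppose there exists τ ≥ 0 such that N_j(λ) = O(λ^τ) as λ → ∞ for every j = 1,…,m. Then the product counting function M(λ) = #{(k_1,…,k_m) ∈ ℕ_{≥1}^m : λ^{(1)}_{k_1} λ^{(2)}_{k_2} ⋯ λ^{(m)}_{k_m} ≤ λ} satisfies M(λ) = O(λ^τ log^m λ) as λ → ∞. -/

import Mathlib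

open Filter Asymptotics Real

/-- The counting function of a sequence of reals: `N(x) = #{k : f k ≤ x}`. -/
noncomputable def countingFn (f : ℕ → ℝ) (x : ℝ) : ℝ :=
  Nat.card {k : ℕ | f k ≤ x}

/-- The counting function of products of `m` sequences. -/
noncomputable def prodCountingFn {m : ℕ} (f : Fin m → ℕ → ℝ) (x : ℝ) : ℝ :=
  Nat.card {k : Fin m → ℕ | ∏ j, f j (k j) ≤ x}


lemma seq_growth (f : ℕ → ℝ) (hmono : Monotone f) (hpos : ∀ k, 0 < f k)
    (htend : Tendsto f atTop atTop) (τ : ℝ)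
    (hN : (countingFn f) =O[atTop] fun x => x ^ τ) :
    ∃ C > 0, ∀ k : ℕ, ((k + 1 : ℕ) : ℝ) ≤ C * f k ^ τ := by
  have h1 := hN.comp_tendsto htend
  have h2 : (fun k : ℕ => ((k + 1 : ℕ) : ℝ)) =O[atTop] (countingFn f ∘ f) := by
    refine IsBigO.of_bound 1 (Eventually.of_forall fun k => ?_)
    have hfin : {i : ℕ | f i ≤ f k}.Finite := by
      obtain ⟨K, hK⟩ := (htend.eventually_gt_atTop (f k)).exists_forall_of_atTop
      refine (Set.finite_lt_nat K).subset fun i hi => ?_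
      by_contra h
      exact absurd (hK i (not_lt.mp h)) (not_lt.mpr hi)
    have hsub : (Finset.range (k + 1) : Set ℕ) ⊆ {i : ℕ | f i ≤ f k} := by
      intro i hi
      have : i < k + 1 := by simpa using hi
      exact hmono (by omega)
    have hc := Set.ncard_le_ncard hsub hfin
    rw [Set.ncard_coe_finset, Finset.card_range] at hc
    have : countingFn f (f k) = ((Set.ncard {i : ℕ | f i ≤ f k} : ℕ) : ℝ) := rfl
    rw [Function.comp, this, one_mul, Real.norm_natCast, Real.norm_natCast]
    exact_mod_cast hc
  obtain ⟨C, hC, h⟩ := bound_of_isBigO_nat_atTop (h2.trans h1)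
  refine ⟨C, hC, fun k => ?_⟩
  have hp := Real.rpow_pos_of_pos (hpos k) τ
  have := h (x := k) (by simpa using hp.ne')
  simpa only [Function.comp, Real.norm_natCast, Real.norm_of_nonneg hp.le] using this

lemma count_prod (m : ℕ) (S : Set (Fin m → ℕ)) (y : ℝ)
    (hS : ∀ k ∈ S, ∏ j, ((k j + 1 : ℕ) : ℝ) ≤ y) (hy : 1 ≤ y) :
    (Nat.card S : ℝ) ≤ y * (1 + Real.log y) ^ m := by
  classical
  set T := Fintype.piFinset (fun _ : Fin m => Finset.range ⌊y⌋₊) with hT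
  have hsub : S ⊆ T := by
    intro k hk
    simp only [hT, Finset.mem_coe, Fintype.mem_piFinset, Finset.mem_range]
    intro j
    have h1 : k j + 1 ≤ ∏ j, (k j + 1) :=
      Finset.single_le_prod' (f := fun j => k j + 1) (fun i _ => by omega) (Finset.mem_univ j)
    have h2 : ∏ j, (k j + 1) ≤ ⌊y⌋₊ := Nat.le_floor (by exact_mod_cast hS k hk)
    omega
  have hfin : S.Finite := T.finite_toSet.subset hsub
  have hsub' : hfin.toFinset ⊆ T := by
    intro k hk
    exact hsub (hfin.mem_toFinset.mp hk)
  have hcard : (Nat.card S : ℝ) = ∑ k ∈ hfin.toFinset, (1 : ℝ) := by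
    have : Nat.card S = S.ncard := rfl
    rw [this, Set.ncard_eq_toFinset_card S hfin]; simp
  rw [hcard]
  calc ∑ k ∈ hfin.toFinset, (1 : ℝ)
      ≤ ∑ k ∈ hfin.toFinset, y * ∏ j, ((k j + 1 : ℕ) : ℝ)⁻¹ := by
        refine Finset.sum_le_sum fun k hk => ?_
        have h := hS k (hfin.mem_toFinset.mp hk)
        have hp : 0 < ∏ j, ((k j + 1 : ℕ) : ℝ) := Finset.prod_pos fun j _ => by positivity
        rw [Finset.prod_inv_distrib, ← div_eq_mul_inv]
        exact (one_le_div hp).mpr h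
    _ ≤ ∑ k ∈ T, y * ∏ j, ((k j + 1 : ℕ) : ℝ)⁻¹ := by
        refine Finset.sum_le_sum_of_subset_of_nonneg hsub' fun k _ _ => ?_
        positivity
    _ = y * (∑ i ∈ Finset.range ⌊y⌋₊, ((i + 1 : ℕ) : ℝ)⁻¹) ^ m := by
        rw [← Finset.mul_sum, hT,
          Finset.sum_prod_piFinset (Finset.range ⌊y⌋₊) (fun _ i => ((i + 1 : ℕ) : ℝ)⁻¹)]
        simp
    _ ≤ y * (1 + Real.log y) ^ m := by
        have h := harmonic_floor_le_one_add_log y hy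
        have e : ((harmonic ⌊y⌋₊ : ℚ) : ℝ) = ∑ i ∈ Finset.range ⌊y⌋₊, ((i + 1 : ℕ) : ℝ)⁻¹ := by
          simp [harmonic]
        rw [e] at h
        gcongr

theorem prod_counting_bigO_of_all_bigO
    {m : ℕ} (hm : 1 ≤ m) (seq : Fin m → ℕ → ℝ)
    (hmono : ∀ j, Monotone (seq j)) (hpos : ∀ j k, 0 < seq j k)
    (htend : ∀ j, Tendsto (seq j) atTop atTop)
    (τ : ℝ) (hτ : 0 ≤ τ)
    (hN : ∀ j, (countingFn (seq j)) =O[atTop] fun x => x ^ τ) :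
    (prodCountingFn seq) =O[atTop] fun x => x ^ τ * Real.log x ^ m := by
  choose C hC hb using fun j => seq_growth (seq j) (hmono j) (hpos j) (htend j) τ (hN j)
  set A : ℝ := max 1 (∏ j, C j) with hA
  have hA1 : 1 ≤ A := le_max_left _ _
  have hlA : 0 ≤ Real.log A := Real.log_nonneg hA1
  refine IsBigO.of_bound (A * (1 + Real.log A + τ) ^ m) ?_
  filter_upwards [eventually_ge_atTop (Real.exp 1)] with x hx
  have hx0 : 0 < x := (Real.exp_pos 1).trans_le hx
  have hx1 : 1 ≤ x := (Real.one_le_exp zero_le_one).trans hx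
  have hl : 1 ≤ Real.log x := (Real.le_log_iff_exp_le hx0).mpr hx
  have hxt : 1 ≤ x ^ τ := Real.one_le_rpow hx1 hτ
  have hy : 1 ≤ A * x ^ τ := one_le_mul_of_one_le_of_one_le hA1 hxt
  have key := count_prod m {k : Fin m → ℕ | ∏ j, seq j (k j) ≤ x} (A * x ^ τ) (by
    intro k hk
    calc ∏ j, ((k j + 1 : ℕ) : ℝ) ≤ ∏ j, (C j * seq j (k j) ^ τ) :=
          Finset.prod_le_prod (fun j _ => by positivity) (fun j _ => hb j (k j))
      _ = (∏ j, C j) * (∏ j, seq j (k j)) ^ τ := by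
          rw [Finset.prod_mul_distrib, Real.finsetProd_rpow _ _ (fun j _ => (hpos j _).le)]
      _ ≤ A * x ^ τ := by
          have h0 : 0 ≤ ∏ j, seq j (k j) := Finset.prod_nonneg fun j _ => (hpos j _).le
          exact mul_le_mul (le_max_right _ _) (Real.rpow_le_rpow h0 hk hτ)
            (Real.rpow_nonneg h0 _) (by linarith)) hy
  have e : Real.log (A * x ^ τ) = Real.log A + τ * Real.log x := by
    rw [Real.log_mul (by linarith) (by linarith), Real.log_rpow hx0]
  rw [e] at key
  have hnn : 0 ≤ x ^ τ * Real.log x ^ m := by positivity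
  rw [Real.norm_of_nonneg hnn]
  have : prodCountingFn seq x = (Nat.card {k : Fin m → ℕ | ∏ j, seq j (k j) ≤ x} : ℝ) := rfl
  rw [this, Real.norm_natCast]
  refine key.trans ?_
  have h3 : 1 + (Real.log A + τ * Real.log x) ≤ (1 + Real.log A + τ) * Real.log x := by
    nlinarith
  have h4 : (1 + (Real.log A + τ * Real.log x)) ^ m ≤ ((1 + Real.log A + τ) * Real.log x) ^ m :=
    pow_le_pow_left₀ (by positivity) h3 m
  calc _ ≤ A * x ^ τ * ((1 + Real.log A + τ) * Real.log x) ^ m := by gcongr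
    _ = _ := by rw [mul_pow]; ring
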